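/- Let n ≥ 1 and let u ∈ ℝ^{n+1} be a unit vector with all entries nonzero. Suppose y : ℝ → ℝ is continuous on E_u, even (y(−x) = y(x)), satisfies y(0) = 0, and satisfies Φ_u(x, y(x)) = 0 for every x ∈ D_u. Then the function s ↦ Re F_u(s + i·y(s)) is integrable on E_u and (1/(2π))·∫_{E_u} Re F_u(s + i·y(s)) ds ≥ 1/e. -/

import Mathlib

open MeasureTheory

/-- The function `F_u(t) = ∏ j, e^{i u_j t} / (1 + i u_j t)`. -/
noncomputable def Fchar {m : ℕ} (u : Fin m → ℝ) (t : ℂ) : ℂ :=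
  ∏ j, Complex.exp (Complex.I * u j * t) / (1 + Complex.I * u j * t)

/-- The continuous inverse cotangent with range `(0, π)`. -/
noncomputable def arccot (θ : ℝ) : ℝ := Real.pi / 2 - Real.arctan θ

/-- The lifting `Φ_u(x, y)` of the argument of `F_u(x + iy)` (for `x > 0`). -/
noncomputable def Phi {m : ℕ} (u : Fin m → ℝ) (x y : ℝ) : ℝ :=
  x * ∑ j, u j
    - ∑ j ∈ Finset.univ.filter (fun j => 0 < u j), arccot ((1 / u j - y) / x)
    + ∑ j ∈ Finset.univ.filter (fun j => u j < 0), arccot (-(1 / u j - y) / x)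

/-- The domain `D_u`. -/
noncomputable def Dset {m : ℕ} (u : Fin m → ℝ) : Set ℝ :=
  {x | 0 < x ∧
    -(((Finset.univ.filter (fun j => u j < 0)).card : ℝ) * Real.pi) < x * ∑ j, u j ∧
    x * ∑ j, u j < ((Finset.univ.filter (fun j => 0 < u j)).card : ℝ) * Real.pi}

/-- The extended (symmetric) domain `E_u`. -/
noncomputable def Eset {m : ℕ} (u : Fin m → ℝ) : Set ℝ :=
  {x | x = 0 ∨ x ∈ Dset u ∨ -x ∈ Dset u}

open Set Filter Topology

lemma le_of_hasDerivAt_nonneg {f f' : ℝ → ℝ} {a b : ℝ} (hab : a ≤ b)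
    (hc : ContinuousOn f (Icc a b)) (hd : ∀ x ∈ Ioo a b, HasDerivAt f (f' x) x)
    (hn : ∀ x ∈ Ioo a b, 0 ≤ f' x) : f a ≤ f b := by
  refine monotoneOn_of_hasDerivWithinAt_nonneg (f' := f') (convex_Icc a b) hc ?_ ?_
    (left_mem_Icc.2 hab) (right_mem_Icc.2 hab) hab
  · intro x hx
    rw [interior_Icc] at hx
    exact (hd x hx).hasDerivWithinAt
  · intro x hx
    rw [interior_Icc] at hx
    exact hn x hx

lemma lt_of_hasDerivAt_pos {f f' : ℝ → ℝ} {a b : ℝ} (hab : a < b)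
    (hc : ContinuousOn f (Icc a b)) (hd : ∀ x ∈ Ioo a b, HasDerivAt f (f' x) x)
    (hn : ∀ x ∈ Ioo a b, 0 < f' x) : f a < f b := by
  refine strictMonoOn_of_hasDerivWithinAt_pos (f' := f') (convex_Icc a b) hc ?_ ?_
    (left_mem_Icc.2 hab.le) (right_mem_Icc.2 hab.le) hab
  · intro x hx
    rw [interior_Icc] at hx
    exact (hd x hx).hasDerivWithinAt
  · intro x hx
    rw [interior_Icc] at hx
    exact hn x hx

lemma sinc_pos {x : ℝ} (h : x ∈ Ioo (-Real.pi) Real.pi) : 0 < Real.sinc x := by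
  rcases lt_trichotomy x 0 with hx | hx | hx
  · rw [← Real.sinc_neg, Real.sinc_of_ne_zero (by linarith)]
    exact div_pos (Real.sin_pos_of_pos_of_lt_pi (by linarith) (by linarith [h.1])) (by linarith)
  · simp [hx]
  · rw [Real.sinc_of_ne_zero hx.ne']
    exact div_pos (Real.sin_pos_of_pos_of_lt_pi hx h.2) hx

/-- The modulus of `F` along the steepest descent curve in dimension one, up to the factor `e`. -/
noncomputable def hankelDensity (x : ℝ) : ℝ :=
  Real.exp (Real.cos x / Real.sinc x) * Real.sinc x

/-- The steepest descent curve of `e^z / z` through `z = 1`. -/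
noncomputable def hankelCurve (x : ℝ) : ℂ :=
  ((Real.cos x / Real.sinc x : ℝ) : ℂ) + (x : ℂ) * Complex.I

lemma exists_primitive_exp_sub_one_div :
    ∃ P : ℂ → ℂ, ∀ z, HasDerivAt P (dslope Complex.exp 0 z) z := by
  have hd : DifferentiableOn ℂ (dslope Complex.exp 0) univ :=
    (Complex.differentiableOn_dslope univ_mem).2 Complex.differentiable_exp.differentiableOn
  obtain ⟨P, hP⟩ := Complex.IsConservativeOn.isExactOn_univ
    (continuousOn_univ.1 hd.continuousOn) hd.isConservativeOn
  exact ⟨P, fun z => hP z (mem_univ z)⟩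

lemma mul_dslope_exp (z : ℂ) : z * dslope Complex.exp 0 z = Complex.exp z - 1 := by
  have := sub_smul_dslope Complex.exp 0 z
  simpa using this

lemma im_primitive_nonneg {P : ℂ → ℂ} (hP : ∀ z, HasDerivAt P (dslope Complex.exp 0 z) z)
    {z : ℂ} (h0 : 0 ≤ z.im) (h1 : z.im ≤ Real.pi) : (P 0).im ≤ (P z).im := by
  have hd : ∀ s : ℝ, HasDerivAt (fun s : ℝ => (P (s * z)).im)
      (z * dslope Complex.exp 0 (s * z)).im s := by
    intro s
    have e1 : HasDerivAt (fun s : ℂ => s * z) z (s : ℂ) := by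
      simpa using (hasDerivAt_id (s : ℂ)).mul_const z
    have e2 := ((hP (s * z)).comp (s : ℂ) e1).comp_ofReal
    have e3 := Complex.imCLM.hasFDerivAt.comp_hasDerivAt s e2
    simpa [Function.comp_def, mul_comm] using! e3
  have := le_of_hasDerivAt_nonneg (f := fun s : ℝ => (P (s * z)).im) zero_le_one
    (fun s _ => (hd s).continuousAt.continuousWithinAt) (fun s _ => hd s) (by
      intro s hs
      have h2 : ((s : ℂ) * z * dslope Complex.exp 0 (s * z)).im
          = Real.exp (s * z.re) * Real.sin (s * z.im) := by
        rw [mul_dslope_exp]; simp [Complex.exp_im]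
      rw [mul_assoc, Complex.im_ofReal_mul] at h2
      have h3 : 0 ≤ Real.sin (s * z.im) := by
        apply Real.sin_nonneg_of_nonneg_of_le_pi (mul_nonneg hs.1.le h0)
        nlinarith [hs.2, hs.1]
      have h4 : 0 ≤ s * (z * dslope Complex.exp 0 (s * z)).im := by
        rw [h2]; positivity
      exact nonneg_of_mul_nonneg_right h4 hs.1)
  simpa using this

lemma im_primitive_nonpos {P : ℂ → ℂ} (hP : ∀ z, HasDerivAt P (dslope Complex.exp 0 z) z)
    {z : ℂ} (h0 : z.im ≤ 0) (h1 : -Real.pi ≤ z.im) : (P z).im ≤ (P 0).im := by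
  have hd : ∀ s : ℝ, HasDerivAt (fun s : ℝ => -(P (s * z)).im)
      (-(z * dslope Complex.exp 0 (s * z)).im) s := by
    intro s
    have e1 : HasDerivAt (fun s : ℂ => s * z) z (s : ℂ) := by
      simpa using (hasDerivAt_id (s : ℂ)).mul_const z
    have e2 := ((hP (s * z)).comp (s : ℂ) e1).comp_ofReal
    have e3 := (Complex.imCLM.hasFDerivAt.comp_hasDerivAt s e2).neg
    simpa [Function.comp_def, mul_comm] using! e3
  have := le_of_hasDerivAt_nonneg (f := fun s : ℝ => -(P (s * z)).im) zero_le_one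
    (fun s _ => (hd s).continuousAt.continuousWithinAt) (fun s _ => hd s) (by
      intro s hs
      have h2 : ((s : ℂ) * z * dslope Complex.exp 0 (s * z)).im
          = Real.exp (s * z.re) * Real.sin (s * z.im) := by
        rw [mul_dslope_exp]; simp [Complex.exp_im]
      rw [mul_assoc, Complex.im_ofReal_mul] at h2
      have h3 : Real.sin (s * z.im) ≤ 0 := by
        apply Real.sin_nonpos_of_nonpos_of_neg_pi_le
          (mul_nonpos_of_nonneg_of_nonpos hs.1.le h0)
        nlinarith [hs.2, hs.1]
      have h4 : 0 ≤ s * -(z * dslope Complex.exp 0 (s * z)).im := by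
        rw [mul_neg, h2]
        have := mul_nonneg (Real.exp_pos (s * z.re)).le (neg_nonneg.2 h3)
        linarith
      exact nonneg_of_mul_nonneg_right h4 hs.1)
  simpa using this

lemma sin_ne_zero_of_mem {x : ℝ} (h : x ∈ Ioo (-Real.pi) Real.pi) (hx : x ≠ 0) :
    Real.sin x ≠ 0 := by
  have := (sinc_pos h).ne'
  rw [Real.sinc_of_ne_zero hx] at this
  intro h0
  simp [h0] at this

lemma hasDerivAt_cos_div_sinc {x : ℝ} (h : x ∈ Ioo (-Real.pi) Real.pi) (hx : x ≠ 0) :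
    HasDerivAt (fun x => Real.cos x / Real.sinc x)
      (Real.cos x / Real.sin x - x / Real.sin x ^ 2) x := by
  have hs := sin_ne_zero_of_mem h hx
  have h1 : HasDerivAt (fun x => x * Real.cos x / Real.sin x)
      (Real.cos x / Real.sin x - x / Real.sin x ^ 2) x := by
    have := ((hasDerivAt_id x).mul (Real.hasDerivAt_cos x)).div (Real.hasDerivAt_sin x) hs
    convert! this using 1
    simp only [id, Pi.mul_apply]
    field_simp
    linear_combination x * Real.sin_sq_add_cos_sq x
  refine h1.congr_of_eventuallyEq ?_
  filter_upwards [isOpen_ne.mem_nhds hx] with z hz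
  rw [Real.sinc_of_ne_zero hz]
  field_simp

lemma continuousOn_cos_div_sinc :
    ContinuousOn (fun x => Real.cos x / Real.sinc x) (Ioo (-Real.pi) Real.pi) :=
  Real.continuous_cos.continuousOn.div Real.continuous_sinc.continuousOn
    fun _ hx => (sinc_pos hx).ne'

lemma continuousOn_hankelDensity : ContinuousOn hankelDensity (Ioo (-Real.pi) Real.pi) :=
  (Real.continuous_exp.comp_continuousOn continuousOn_cos_div_sinc).mul
    Real.continuous_sinc.continuousOn

lemma hasDerivAt_im_primitive_hankelCurve {P : ℂ → ℂ}
    (hP : ∀ z, HasDerivAt P (dslope Complex.exp 0 z) z) {x : ℝ}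
    (h : x ∈ Ioo (-Real.pi) Real.pi) (hx : x ≠ 0) :
    HasDerivAt (fun x => (P (hankelCurve x)).im + x) (hankelDensity x) x := by
  have hs := sin_ne_zero_of_mem h hx
  set r' := Real.cos x / Real.sin x - x / Real.sin x ^ 2 with hr'
  have hz : HasDerivAt hankelCurve ((r' : ℂ) + Complex.I) x := by
    have e1 := (hasDerivAt_cos_div_sinc h hx).ofReal_comp
    have e2 := ((hasDerivAt_id x).ofReal_comp).mul_const Complex.I
    have e3 := e1.add e2
    rw [Complex.ofReal_one, one_mul] at e3
    exact e3
  have e1 := (hP (hankelCurve x)).comp_of_eq x hz rfl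
  have e3 := (Complex.imCLM.hasFDerivAt.comp_hasDerivAt x e1).add (hasDerivAt_id x)
  convert! e3 using 1
  set Q := dslope Complex.exp 0 (hankelCurve x) with hQ
  have hm : hankelCurve x * Q = Complex.exp (hankelCurve x) - 1 := mul_dslope_exp _
  have hzre : (hankelCurve x).re = Real.cos x / Real.sinc x := by
    simp only [hankelCurve, Complex.add_re, Complex.ofReal_re, Complex.mul_re, Complex.I_re,
      Complex.ofReal_im, Complex.I_im]
    ring
  have hzim : (hankelCurve x).im = x := by simp [hankelCurve]
  have a1 := congrArg Complex.re hm
  have a2 := congrArg Complex.im hm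
  simp only [Complex.mul_re, Complex.mul_im, Complex.sub_re, Complex.sub_im, Complex.exp_re,
    Complex.exp_im, hzre, hzim, Complex.one_re, Complex.one_im] at a1 a2
  simp only [Complex.imCLM_apply, Complex.mul_im, Complex.add_re, Complex.add_im,
    Complex.ofReal_re, Complex.ofReal_im, Complex.I_re, Complex.I_im, hankelDensity]
  rw [Real.sinc_of_ne_zero hx] at a1 a2 ⊢
  have hE : Real.cos x / (Real.sin x / x) = x * Real.cos x / Real.sin x := by field_simp
  rw [hE] at a1 a2 ⊢
  generalize Real.exp (x * Real.cos x / Real.sin x) = E at *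
  generalize Q.re = q at *
  generalize Q.im = p at *
  rw [hr']
  have hcs := Real.sin_sq_add_cos_sq x
  generalize Real.sin x = s at *
  generalize Real.cos x = c at *
  field_simp at a1 a2
  have hq : q = s * (E - c) / x := by
    rw [eq_div_iff hx]
    linear_combination c * a1 + s * a2 + (s * E - q * x) * hcs
  have hp : p = s ^ 2 / x := by
    rw [eq_div_iff hx]
    linear_combination c * a2 - s * a1 - p * x * hcs
  rw [hq, hp]
  field_simp
  ring

lemma le_integral_hankelDensity {X : ℝ} (h0 : 0 ≤ X) (hX : X < Real.pi) :
    2 * X ≤ ∫ x in (-X)..X, hankelDensity x := by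
  obtain ⟨P, hP⟩ := exists_primitive_exp_sub_one_div
  have hsub : Icc (-X) X ⊆ Ioo (-Real.pi) Real.pi := fun x hx =>
    ⟨by linarith [hx.1], by linarith [hx.2]⟩
  have hPc : Continuous P := continuous_iff_continuousAt.2 fun z => (hP z).continuousAt
  have hc : ContinuousOn hankelCurve (Ioo (-Real.pi) Real.pi) :=
    (Complex.continuous_ofReal.comp_continuousOn continuousOn_cos_div_sinc).add
      (by fun_prop)
  have := MeasureTheory.integral_eq_of_hasDerivAt_off_countable_of_le
    (fun x => (P (hankelCurve x)).im + x) hankelDensity (a := -X) (b := X) (by linarith)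
    (countable_singleton (0 : ℝ))
    (((Complex.continuous_im.comp hPc).comp_continuousOn (hc.mono hsub)).add continuousOn_id)
    (fun x hx => hasDerivAt_im_primitive_hankelCurve hP (hsub (Ioo_subset_Icc_self hx.1)) hx.2)
    (by
      apply ContinuousOn.intervalIntegrable
      rw [uIcc_of_le (by linarith)]
      exact continuousOn_hankelDensity.mono hsub)
  rw [this]
  have h1 := im_primitive_nonneg hP (z := hankelCurve X) (by simpa [hankelCurve] using h0)
    (by simpa [hankelCurve] using hX.le)
  have h2 := im_primitive_nonpos hP (z := hankelCurve (-X)) (by simpa [hankelCurve] using h0)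
    (by simpa [hankelCurve] using hX.le)
  linarith

/-- The exponent of the decay of `F` along the steepest descent curve in dimension one. -/
noncomputable def decay (x : ℝ) : ℝ := 1 - Real.cos x / Real.sinc x - Real.log (Real.sinc x)

lemma exp_neg_decay {x : ℝ} (h : x ∈ Ioo (-Real.pi) Real.pi) :
    Real.exp (-decay x) = Real.exp (-1) * hankelDensity x := by
  rw [decay, hankelDensity, ← mul_assoc, ← Real.exp_add]
  conv_rhs => rw [← Real.exp_log (sinc_pos h), ← Real.exp_add]
  rw [Real.exp_log (sinc_pos h)]
  congr 1
  ring

lemma decay_of_pos {x : ℝ} (hx : 0 < x) :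
    decay x = 1 - x * Real.cos x / Real.sin x - Real.log (Real.sin x / x) := by
  rw [decay, Real.sinc_of_ne_zero hx.ne']
  congr 2
  field_simp

lemma continuousOn_decay : ContinuousOn decay (Ioo (-Real.pi) Real.pi) :=
  (continuousOn_const.sub continuousOn_cos_div_sinc).sub
    (Real.continuous_sinc.continuousOn.log fun _ hx => (sinc_pos hx).ne')

lemma hasDerivAt_decay {x : ℝ} (hx : x ∈ Ioo 0 Real.pi) :
    HasDerivAt decay
      (x / Real.sin x ^ 2 - 2 * Real.cos x / Real.sin x + 1 / x) x := by
  have hx' : x ∈ Ioo (-Real.pi) Real.pi := ⟨by linarith [hx.1, Real.pi_pos], hx.2⟩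
  have hs := (Real.sin_pos_of_pos_of_lt_pi hx.1 hx.2).ne'
  have hx0 := hx.1.ne'
  have e1 := hasDerivAt_cos_div_sinc hx' hx.1.ne'
  have e2 : HasDerivAt Real.sinc ((Real.cos x * x - Real.sin x) / x ^ 2) x := by
    have := (Real.hasDerivAt_sin x).div (hasDerivAt_id x) hx.1.ne'
    rw [id, mul_one] at this
    refine this.congr_of_eventuallyEq ?_
    filter_upwards [isOpen_ne.mem_nhds hx.1.ne'] with z hz
    rw [Real.sinc_of_ne_zero hz]
    rfl
  have e3 := ((hasDerivAt_const x (1 : ℝ)).sub e1).sub (e2.log (sinc_pos hx').ne')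
  convert! e3 using 1
  rw [Real.sinc_of_ne_zero hx0]
  field_simp
  ring

lemma decay_div_sq_le {a x : ℝ} (ha : 0 < a) (hax : a ≤ x) (hx : x < Real.pi) :
    decay a / a ^ 2 ≤ decay x / x ^ 2 := by
  have hd : ∀ z ∈ Icc a x, HasDerivAt (fun z => decay z / z ^ 2)
      (((z / Real.sin z ^ 2 - 2 * Real.cos z / Real.sin z + 1 / z) * z ^ 2 - decay z * (2 * z))
        / (z ^ 2) ^ 2) z := by
    intro z hz
    have hz0 : 0 < z := by linarith [hz.1]
    have := (hasDerivAt_decay ⟨hz0, by linarith [hz.2]⟩).div (hasDerivAt_pow 2 z)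
      (by positivity)
    simpa using! this
  refine le_of_hasDerivAt_nonneg hax (fun z hz => (hd z hz).continuousAt.continuousWithinAt)
    (fun z hz => hd z (Ioo_subset_Icc_self hz)) fun z hz => ?_
  have hz0 : 0 < z := by linarith [hz.1]
  have hs := Real.sin_pos_of_pos_of_lt_pi hz0 (by linarith [hz.2])
  apply div_nonneg _ (by positivity)
  rw [decay_of_pos hz0]
  have h1 := Real.log_le_sub_one_of_pos (x := (z / Real.sin z) ^ 2) (by positivity)
  have h2 : Real.log ((z / Real.sin z) ^ 2) = -2 * Real.log (Real.sin z / z) := by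
    rw [Real.log_pow, ← inv_div (Real.sin z) z, Real.log_inv]
    norm_num
  rw [h2] at h1
  have h3 : (z / Real.sin z ^ 2 - 2 * Real.cos z / Real.sin z + 1 / z) * z ^ 2 -
      (1 - z * Real.cos z / Real.sin z - Real.log (Real.sin z / z)) * (2 * z)
      = z * ((z / Real.sin z) ^ 2 - 1 - -2 * Real.log (Real.sin z / z)) := by
    field_simp
    ring
  rw [h3]
  apply mul_nonneg hz0.le
  linarith

lemma sq_div_two_le_decay {x : ℝ} (h0 : 0 < x) (hx : x < Real.pi) :
    x ^ 2 / 2 ≤ decay x := by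
  have hsub : Icc 0 x ⊆ Ioo (-Real.pi) Real.pi := fun z hz =>
    ⟨by linarith [hz.1, Real.pi_pos], by linarith [hz.2]⟩
  have := le_of_hasDerivAt_nonneg (f := fun z => decay z - z ^ 2 / 2)
    (f' := fun z => (z / Real.sin z ^ 2 - 2 * Real.cos z / Real.sin z + 1 / z) - z) h0.le
    ((continuousOn_decay.mono hsub).sub (by fun_prop))
    (fun z hz => by
      have e1 := hasDerivAt_decay (x := z) ⟨hz.1, by linarith [hz.2]⟩
      have e2 := (hasDerivAt_pow 2 z).div_const 2
      simpa using! e1.sub e2)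
    (fun z hz => by
      have hz0 := hz.1
      have hs := Real.sin_pos_of_pos_of_lt_pi hz.1 (by linarith [hz.2])
      have h3 : (z / Real.sin z ^ 2 - 2 * Real.cos z / Real.sin z + 1 / z) - z
          = (z * Real.cos z / Real.sin z - 1) ^ 2 / z := by
        field_simp
        linear_combination (-z ^ 2) * Real.sin_sq_add_cos_sq z
      rw [h3]
      positivity)
  simp [decay] at this
  simp only [decay]
  linarith

/-- The argument of `1 - a c + i a`. -/
noncomputable def angle (c a : ℝ) : ℝ := (Complex.log (1 + a * (Complex.I - c))).im

/-- The real part of `(1 - i c) log (1 - a c + i a)`. -/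
noncomputable def loss (c a : ℝ) : ℝ :=
  (Complex.log (1 + a * (Complex.I - c))).re + c * angle c a

lemma normSq_pos (c a : ℝ) : 0 < (1 - a * c) ^ 2 + a ^ 2 := by
  rcases eq_or_ne a 0 with rfl | h
  · norm_num
  · positivity

lemma mem_slitPlane (c a : ℝ) : (1 + a * (Complex.I - c) : ℂ) ∈ Complex.slitPlane := by
  rw [Complex.mem_slitPlane_iff]
  rcases eq_or_ne a 0 with rfl | h
  · left; simp
  · right; simpa using h

lemma hasDerivAt_log_point (c a : ℝ) :
    HasDerivAt (fun a : ℝ => Complex.log (1 + a * (Complex.I - c)))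
      ((Complex.I - c) / (1 + a * (Complex.I - c))) a := by
  refine HasDerivAt.clog_real ?_ (mem_slitPlane c a)
  have := ((hasDerivAt_id a).ofReal_comp.mul_const (Complex.I - c)).const_add 1
  simpa using! this

lemma normSq_point (c a : ℝ) :
    Complex.normSq (1 + a * (Complex.I - c)) = (1 - a * c) ^ 2 + a ^ 2 := by
  simp [Complex.normSq_apply]
  ring

lemma hasDerivAt_angle (c a : ℝ) :
    HasDerivAt (angle c) (1 / ((1 - a * c) ^ 2 + a ^ 2)) a := by
  have := Complex.imCLM.hasFDerivAt.comp_hasDerivAt a (hasDerivAt_log_point c a)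
  convert! this using 1
  have h := (normSq_pos c a).ne'
  simp only [Complex.imCLM_apply, Complex.div_im, normSq_point]
  simp
  field_simp
  ring

lemma hasDerivAt_loss (c a : ℝ) :
    HasDerivAt (loss c) ((1 + c ^ 2) * a / ((1 - a * c) ^ 2 + a ^ 2)) a := by
  have := Complex.reCLM.hasFDerivAt.comp_hasDerivAt a (hasDerivAt_log_point c a)
  have := this.add ((hasDerivAt_angle c a).const_mul c)
  convert! this using 1
  have h := (normSq_pos c a).ne'
  simp only [Complex.reCLM_apply, Complex.div_re, normSq_point]
  simp
  field_simp
  ring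

lemma angle_zero (c : ℝ) : angle c 0 = 0 := by simp [angle]

lemma loss_zero (c : ℝ) : loss c 0 = 0 := by simp [loss, angle]

lemma continuous_angle (c : ℝ) : Continuous (angle c) :=
  continuous_iff_continuousAt.2 fun a => (hasDerivAt_angle c a).continuousAt

lemma continuous_loss (c : ℝ) : Continuous (loss c) :=
  continuous_iff_continuousAt.2 fun a => (hasDerivAt_loss c a).continuousAt

lemma log_point_neg (c a : ℝ) : Complex.log (1 + (-a : ℝ) * (Complex.I - (-c : ℝ)))
    = (starRingEnd ℂ) (Complex.log (1 + a * (Complex.I - c))) := by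
  rw [← Complex.log_conj _ (Complex.slitPlane_arg_ne_pi (mem_slitPlane c a))]
  congr 1
  simp
  ring

lemma angle_neg (c a : ℝ) : angle (-c) (-a) = -angle c a := by
  rw [angle, log_point_neg]; simp [angle]

lemma loss_neg (c a : ℝ) : loss (-c) (-a) = loss c a := by
  rw [loss, log_point_neg, angle_neg]; simp [loss]

lemma exp_log_point (c a : ℝ) :
    Complex.exp (Complex.log (1 + a * (Complex.I - c))) = 1 + a * (Complex.I - c) :=
  Complex.exp_log (Complex.slitPlane_ne_zero (mem_slitPlane c a))

lemma log_point_re (c a : ℝ) : (Complex.log (1 + a * (Complex.I - c))).re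
    = Real.log ((1 - a * c) ^ 2 + a ^ 2) / 2 := by
  rw [Complex.log_re, ← normSq_point, Complex.normSq_eq_norm_sq, Real.log_pow]
  norm_num

lemma loss_nonneg (c a : ℝ) : 0 ≤ loss c a := by
  have key : ∀ c a : ℝ, 0 ≤ a → 0 ≤ loss c a := by
    intro c a ha
    rw [← loss_zero c]
    refine le_of_hasDerivAt_nonneg ha (continuous_loss c).continuousOn
      (fun z _ => hasDerivAt_loss c z) fun z hz => ?_
    have := normSq_pos c z
    have := hz.1
    positivity
  rcases le_total 0 a with h | h
  · exact key c a h
  · rw [← loss_neg]; exact key _ _ (by linarith)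

lemma hasDerivAt_sub_angle (c a : ℝ) :
    HasDerivAt (fun a => a - angle c a)
      (a * ((1 + c ^ 2) * a - 2 * c) / ((1 - a * c) ^ 2 + a ^ 2)) a := by
  convert! (hasDerivAt_id a).sub (hasDerivAt_angle c a) using 1
  have h := (normSq_pos c a).ne'
  field_simp
  ring

lemma continuous_sub_angle (c : ℝ) : Continuous fun a => a - angle c a :=
  continuous_id.sub (continuous_angle c)

lemma lt_angle_of_le {c a : ℝ} (hc : 0 < c) (ha0 : a ≠ 0) (ha : (1 + c ^ 2) * a ≤ 2 * c) :
    a < angle c a := by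
  rcases ha0.lt_or_gt with h | h
  · have := lt_of_hasDerivAt_pos h (continuous_sub_angle c).continuousOn
      (fun z _ => hasDerivAt_sub_angle c z) (fun z hz => by
        apply div_pos _ (normSq_pos c z)
        have h1 : (1 + c ^ 2) * z < 0 := mul_neg_of_pos_of_neg (by positivity) hz.2
        exact mul_pos_of_neg_of_neg hz.2 (by linarith))
    rw [angle_zero] at this
    linarith
  · have := lt_of_hasDerivAt_pos h (continuous_sub_angle c).neg.continuousOn
      (fun z _ => (hasDerivAt_sub_angle c z).neg) (fun z hz => by
        rw [← neg_div]
        apply div_pos _ (normSq_pos c z)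
        have h1 : (1 + c ^ 2) * z < (1 + c ^ 2) * a :=
          mul_lt_mul_of_pos_left hz.2 (by positivity)
        nlinarith [mul_pos hz.1 (show 0 < 2 * c - (1 + c ^ 2) * z by linarith)])
    simp only [angle_zero, Pi.neg_apply] at this
    linarith

lemma exists_angle_eq {c a : ℝ} (hc : 0 < c) (ha0 : a ≠ 0) (ha : angle c a ≤ a) :
    ∃ a₀, 0 < a₀ ∧ a₀ ≤ a ∧ 2 * c < (1 + c ^ 2) * a₀ ∧ angle c a₀ = a₀ := by
  set b := 2 * c / (1 + c ^ 2) with hb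
  have hb0 : 0 < b := by positivity
  have hbe : (1 + c ^ 2) * b = 2 * c := by rw [hb]; field_simp
  have hlt := lt_angle_of_le hc hb0.ne' hbe.le
  have hba : b ≤ a := by
    by_contra! h
    have := lt_angle_of_le hc ha0
      ((mul_le_mul_of_nonneg_left h.le (by positivity)).trans hbe.le)
    linarith
  obtain ⟨a₀, h1, h2⟩ := intermediate_value_Icc hba (continuous_sub_angle c).continuousOn
    (show (0 : ℝ) ∈ Icc (b - angle c b) (a - angle c a) from ⟨by linarith, by linarith⟩)
  simp only at h2
  have hne : b ≠ a₀ := by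
    rintro rfl
    linarith
  have hlt' : b < a₀ := lt_of_le_of_ne h1.1 hne
  refine ⟨a₀, by linarith, h1.2, ?_, by linarith⟩
  rw [← hbe]
  exact mul_lt_mul_of_pos_left hlt' (by positivity)

lemma exists_tangent_bound {c a₀ : ℝ} (h0 : 0 < a₀) (h1 : 2 * c < (1 + c ^ 2) * a₀)
    (h2 : angle c a₀ = a₀) :
    ∃ μ, ∀ a, loss c a ≤ loss c a₀ / a₀ ^ 2 * a ^ 2 + μ * (a - angle c a) := by
  set l := loss c a₀ / a₀ ^ 2 with hl
  have hlpos : 0 ≤ l := div_nonneg (loss_nonneg c a₀) (by positivity)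
  set Q : ℝ → ℝ → ℝ := fun μ a => 2 * l * ((1 - a * c) ^ 2 + a ^ 2) +
    μ * ((1 + c ^ 2) * a - 2 * c) - (1 + c ^ 2) with hQ
  obtain ⟨μ, hμ⟩ : ∃ μ, Q μ a₀ = 0 := by
    have : (1 + c ^ 2) * a₀ - 2 * c ≠ 0 := by linarith
    refine ⟨((1 + c ^ 2) - 2 * l * ((1 - a₀ * c) ^ 2 + a₀ ^ 2)) / ((1 + c ^ 2) * a₀ - 2 * c), ?_⟩
    simp only [hQ]
    rw [div_mul_cancel₀ _ this]
    ring
  set K : ℝ → ℝ := fun a => l * a ^ 2 + μ * (a - angle c a) - loss c a with hK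
  have hd : ∀ a, HasDerivAt K (a * Q μ a / ((1 - a * c) ^ 2 + a ^ 2)) a := by
    intro a
    have := (((hasDerivAt_pow 2 a).const_mul l).add
      ((hasDerivAt_sub_angle c a).const_mul μ)).sub (hasDerivAt_loss c a)
    convert! this using 1
    have h := (normSq_pos c a).ne'
    simp only [hQ]
    field_simp
    ring
  have hcont : Continuous K := continuous_iff_continuousAt.2 fun a => (hd a).continuousAt
  have hK0 : K 0 = 0 := by simp [hK, angle_zero, loss_zero]
  have hKa : K a₀ = 0 := by
    simp only [hK, h2, hl]
    field_simp
    ring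
  obtain ⟨r, hr, hr0⟩ := exists_hasDerivAt_eq_zero h0 hcont.continuousOn (hK0.trans hKa.symm)
    (fun a _ => hd a)
  have hQr : Q μ r = 0 := by
    rw [div_eq_zero_iff, mul_eq_zero] at hr0
    rcases hr0 with (h | h) | h
    · exact absurd h hr.1.ne'
    · exact h
    · exact absurd h (normSq_pos c r).ne'
  have hfac : ∀ a, Q μ a = 2 * l * (1 + c ^ 2) * ((a - r) * (a - a₀)) := by
    intro a
    have hne : r - a₀ ≠ 0 := by linarith [hr.2]
    simp only [hQ] at hQr hμ ⊢
    apply mul_left_cancel₀ hne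
    linear_combination (a - a₀) * hQr - (a - r) * hμ
  have hA : 0 ≤ 2 * l * (1 + c ^ 2) := by positivity
  refine ⟨μ, fun a => ?_⟩
  suffices 0 ≤ K a by simp only [hK] at this; linarith
  have hup : ∀ a b : ℝ, a ≤ b → (∀ z ∈ Ioo a b, 0 ≤ z * ((z - r) * (z - a₀))) → K a ≤ K b := by
    intro a b hab h
    refine le_of_hasDerivAt_nonneg hab hcont.continuousOn (fun z _ => hd z) fun z hz => ?_
    apply div_nonneg _ (normSq_pos c z).le
    rw [hfac, mul_left_comm]
    exact mul_nonneg hA (h z hz)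
  have hdown : ∀ a b : ℝ, a ≤ b → (∀ z ∈ Ioo a b, 0 ≤ -(z * ((z - r) * (z - a₀)))) →
      K b ≤ K a := by
    intro a b hab h
    refine neg_le_neg_iff.1 (le_of_hasDerivAt_nonneg (f := fun z => -K z) hab
      hcont.neg.continuousOn (fun z _ => (hd z).neg) fun z hz => ?_)
    rw [← neg_div]
    apply div_nonneg _ (normSq_pos c z).le
    rw [hfac, mul_left_comm, ← mul_neg]
    exact mul_nonneg hA (h z hz)
  obtain ⟨hr1, hr2⟩ := hr
  rcases le_total a 0 with ha | ha
  · rw [← hK0]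
    refine hdown _ _ ha fun z hz => ?_
    have := mul_nonneg (mul_nonneg (show 0 ≤ -z by linarith [hz.2])
      (show 0 ≤ r - z by linarith [hz.2])) (show 0 ≤ a₀ - z by linarith [hz.2])
    linarith
  rcases le_total a r with har | har
  · rw [← hK0]
    refine hup _ _ ha fun z hz => ?_
    have := mul_nonneg (mul_nonneg (show 0 ≤ z by linarith [hz.1])
      (show 0 ≤ r - z by linarith [hz.2])) (show 0 ≤ a₀ - z by linarith [hz.2])
    linarith
  rcases le_total a a₀ with haa | haa
  · rw [← hKa]
    refine hdown _ _ haa fun z hz => ?_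
    have := mul_nonneg (mul_nonneg (show 0 ≤ z by linarith [hz.1])
      (show 0 ≤ z - r by linarith [hz.1])) (show 0 ≤ a₀ - z by linarith [hz.2])
    linarith
  · rw [← hKa]
    refine hup _ _ haa fun z hz => ?_
    have := mul_nonneg (mul_nonneg (show 0 ≤ z by linarith [hz.1])
      (show 0 ≤ z - r by linarith [hz.1])) (show 0 ≤ z - a₀ by linarith [hz.1])
    linarith

lemma loss_eq_decay {c a : ℝ} (h0 : 0 < a) (h1 : a < Real.pi) (h2 : angle c a = a) :
    loss c a = decay a := by
  have hs := Real.sin_pos_of_pos_of_lt_pi h0 h1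
  have he := exp_log_point c a
  have hre := congrArg Complex.re he
  have him := congrArg Complex.im he
  rw [Complex.exp_re, ← angle, h2] at hre
  rw [Complex.exp_im, ← angle, h2] at him
  have e1 : ((1 : ℂ) + a * (Complex.I - c)).re = 1 - a * c := by simp; ring
  have e2 : ((1 : ℂ) + a * (Complex.I - c)).im = a := by simp
  rw [e1] at hre
  rw [e2] at him
  rw [loss, h2, decay_of_pos h0]
  set R := (Complex.log (1 + a * (Complex.I - c))).re
  have hR : R = -Real.log (Real.sin a / a) := by
    rw [← Real.log_inv, inv_div, ← eq_div_iff hs.ne' |>.2 him, Real.log_exp]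
  have hE := eq_div_of_mul_eq hs.ne' him
  rw [hE] at hre
  rw [hR]
  have : c * a = 1 - a * Real.cos a / Real.sin a := by
    rw [show c * a = 1 - (1 - a * c) by ring, ← hre]
    ring
  linarith

lemma loss_zero_le (a : ℝ) : loss 0 a ≤ a ^ 2 / 2 := by
  rw [loss, log_point_re]
  have := Real.log_le_sub_one_of_pos (normSq_pos 0 a)
  linarith

lemma sum_loss_le_of_pos {m : ℕ} {c x : ℝ} {a : Fin m → ℝ} (hc : 0 < c) (ha : ∀ j, a j ≠ 0)
    (hx0 : 0 < x) (hx : x < Real.pi) (hsq : ∑ j, a j ^ 2 = x ^ 2)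
    (hang : ∑ j, a j = ∑ j, angle c (a j)) : ∑ j, loss c (a j) ≤ decay x := by
  obtain ⟨j, hj⟩ : ∃ j, angle c (a j) ≤ a j := by
    by_contra! h
    rcases isEmpty_or_nonempty (Fin m) with he | he
    · simp at hsq
      exact (pow_pos hx0 2).ne hsq
    · exact hang.not_lt (Finset.sum_lt_sum_of_nonempty Finset.univ_nonempty fun j _ => h j)
  obtain ⟨a₀, h0, h1, h2, h3⟩ := exists_angle_eq hc (ha j) hj
  have hjx : a j ≤ x := by
    apply le_of_sq_le_sq _ hx0.le
    rw [← hsq]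
    exact Finset.single_le_sum (f := fun j => a j ^ 2) (fun i _ => sq_nonneg _)
      (Finset.mem_univ j)
  obtain ⟨μ, hμ⟩ := exists_tangent_bound h0 h2 h3
  have hm := decay_div_sq_le h0 (h1.trans hjx) hx
  calc ∑ j, loss c (a j)
      ≤ ∑ j, (loss c a₀ / a₀ ^ 2 * a j ^ 2 + μ * (a j - angle c (a j))) :=
        Finset.sum_le_sum fun j _ => hμ (a j)
    _ = loss c a₀ / a₀ ^ 2 * x ^ 2 := by
        rw [Finset.sum_add_distrib, ← Finset.mul_sum, ← Finset.mul_sum, Finset.sum_sub_distrib,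
          hsq, hang]
        ring
    _ ≤ decay x / x ^ 2 * x ^ 2 := by
        rw [loss_eq_decay h0 (by linarith) h3]
        gcongr
    _ = decay x := by field_simp

lemma sum_loss_le {m : ℕ} {c x : ℝ} {a : Fin m → ℝ} (ha : ∀ j, a j ≠ 0)
    (hx0 : 0 < x) (hx : x < Real.pi) (hsq : ∑ j, a j ^ 2 = x ^ 2)
    (hang : ∑ j, a j = ∑ j, angle c (a j)) : ∑ j, loss c (a j) ≤ decay x := by
  rcases lt_trichotomy c 0 with hc | rfl | hc
  · have := sum_loss_le_of_pos (c := -c) (a := fun j => -a j) (by linarith)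
      (fun j => neg_ne_zero.2 (ha j)) hx0 hx (by simpa using hsq)
      (by simp only [angle_neg, Finset.sum_neg_distrib, hang])
    simpa only [loss_neg] using this
  · calc ∑ j, loss 0 (a j) ≤ ∑ j, a j ^ 2 / 2 := Finset.sum_le_sum fun j _ => loss_zero_le _
      _ = x ^ 2 / 2 := by rw [← Finset.sum_div, hsq]
      _ ≤ decay x := sq_div_two_le_decay hx0 hx
  · exact sum_loss_le_of_pos hc ha hx0 hx hsq hang

lemma angle_of_pos {c a : ℝ} (ha : 0 < a) : angle c a = arccot ((1 - a * c) / a) := by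
  set v := (1 - a * c) / a with hv
  have h1 := Real.neg_pi_div_two_lt_arctan v
  have h2 := Real.arctan_lt_pi_div_two v
  have hs : 0 < √(1 + v ^ 2) := by positivity
  have hpt : (1 + a * (Complex.I - c) : ℂ) = ((a * √(1 + v ^ 2) : ℝ) : ℂ) *
      (Complex.cos (arccot v : ℝ) + Complex.sin (arccot v : ℝ) * Complex.I) := by
    rw [← Complex.ofReal_cos, ← Complex.ofReal_sin, arccot, Real.cos_pi_div_two_sub,
      Real.sin_pi_div_two_sub, Real.sin_arctan, Real.cos_arctan]
    apply Complex.ext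
    · simp
      field_simp
      rw [hv]
      field_simp
      ring
    · simp
      field_simp
  rw [angle, Complex.log_im, hpt, Complex.arg_mul_cos_add_sin_mul_I (by positivity)]
  constructor <;> rw [arccot] <;> linarith [Real.pi_pos]

lemma sum_eq_sum_angle {m : ℕ} {u : Fin m → ℝ} (hnz : ∀ j, u j ≠ 0) {x y : ℝ} (hx : 0 < x)
    (h : Phi u x y = 0) : ∑ j, u j * x = ∑ j, angle (y / x) (u j * x) := by
  have h1 : ∀ j ∈ Finset.univ.filter (fun j => 0 < u j),
      arccot ((1 / u j - y) / x) = angle (y / x) (u j * x) := by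
    intro j hj
    have hu : 0 < u j := by simpa using hj
    rw [angle_of_pos (by positivity)]
    congr 1
    field_simp
  have h2 : ∀ j ∈ Finset.univ.filter (fun j => u j < 0),
      arccot (-(1 / u j - y) / x) = -angle (y / x) (u j * x) := by
    intro j hj
    have hu : u j < 0 := by simpa using hj
    rw [← angle_neg, angle_of_pos (by nlinarith)]
    congr 1
    have := hu.ne
    field_simp
  rw [Phi, Finset.sum_congr rfl h1, Finset.sum_congr rfl h2, Finset.sum_neg_distrib] at h
  have h3 : Finset.univ.filter (fun j => u j < 0) = Finset.univ.filter (fun j => ¬ 0 < u j) := by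
    apply Finset.filter_congr
    intro j _
    rw [not_lt]
    exact ⟨le_of_lt, fun h => lt_of_le_of_ne h (hnz j)⟩
  rw [h3] at h
  rw [← Finset.sum_filter_add_sum_filter_not Finset.univ (fun j => 0 < u j)
    (fun j => angle (y / x) (u j * x)), ← Finset.sum_mul]
  linarith

lemma Fchar_eq_exp {m : ℕ} {u : Fin m → ℝ} {x y : ℝ} (hx : 0 < x)
    (h : ∑ j, u j * x = ∑ j, angle (y / x) (u j * x)) :
    Fchar u (x + Complex.I * y) = (Real.exp (-∑ j, loss (y / x) (u j * x)) : ℝ) := by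
  have hx' : (x : ℂ) ≠ 0 := by exact_mod_cast hx.ne'
  have hf : ∀ j, Complex.exp (Complex.I * u j * (x + Complex.I * y)) /
      (1 + Complex.I * u j * (x + Complex.I * y)) =
      Complex.exp (((u j * x : ℝ) : ℂ) * (Complex.I - (y / x : ℝ)) -
        Complex.log (1 + (u j * x : ℝ) * (Complex.I - (y / x : ℝ)))) := by
    intro j
    have : Complex.I * u j * (x + Complex.I * y) =
        ((u j * x : ℝ) : ℂ) * (Complex.I - (y / x : ℝ)) := by
      push_cast
      field_simp
      linear_combination (u j * y : ℂ) * Complex.I_sq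
    rw [this, Complex.exp_sub, exp_log_point]
  rw [Fchar, Finset.prod_congr rfl fun j _ => hf j, ← Complex.exp_sum, Complex.ofReal_exp]
  congr 1
  apply Complex.ext
  · rw [Complex.re_sum, Complex.ofReal_re, ← Finset.sum_neg_distrib]
    simp only [loss, Complex.sub_re, Complex.re_ofReal_mul, Complex.I_re, Complex.ofReal_re]
    have : ∑ j, u j * x * (y / x) = ∑ j, y / x * angle (y / x) (u j * x) := by
      rw [← Finset.sum_mul, ← Finset.mul_sum, h, mul_comm]
    rw [← sub_eq_zero, ← Finset.sum_sub_distrib]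
    rw [← sub_eq_zero, ← Finset.sum_sub_distrib] at this
    rw [← neg_eq_zero, ← Finset.sum_neg_distrib]
    refine Eq.trans ?_ this
    apply Finset.sum_congr rfl
    intro j _
    ring
  · rw [Complex.im_sum, Complex.ofReal_im]
    simp only [Complex.sub_im, Complex.im_ofReal_mul, Complex.I_im, Complex.ofReal_im]
    rw [Finset.sum_sub_distrib, sub_eq_zero]
    simpa [angle] using h

lemma Fchar_neg_re {m : ℕ} (u : Fin m → ℝ) (x y : ℝ) :
    (Fchar u ((-x : ℝ) + Complex.I * y)).re = (Fchar u (x + Complex.I * y)).re := by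
  rw [← Complex.conj_re (Fchar u (x + Complex.I * y))]
  congr 1
  simp only [Fchar, map_prod, map_div₀, ← Complex.exp_conj, map_add, map_mul, map_one,
    Complex.conj_I, Complex.conj_ofReal]
  apply Finset.prod_congr rfl
  intro j _
  push_cast
  congr 2 <;> ring

lemma log_abs_le_log_point_re (c : ℝ) {a : ℝ} (ha : a ≠ 0) :
    Real.log |a| ≤ (Complex.log (1 + a * (Complex.I - c))).re := by
  rw [log_point_re]
  have := Real.log_le_log (x := |a| ^ 2) (y := (1 - a * c) ^ 2 + a ^ 2) (by positivity) (by
    rw [sq_abs]; nlinarith [sq_nonneg (1 - a * c)])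
  rw [Real.log_pow] at this
  push_cast at this
  linarith

lemma exp_neg_sum_loss_le {m : ℕ} {c : ℝ} {a : Fin m → ℝ} (ha : ∀ j, a j ≠ 0)
    (h0 : ∑ j, a j = 0) (h : ∑ j, a j = ∑ j, angle c (a j)) :
    Real.exp (-∑ j, loss c (a j)) ≤ ∏ j, |a j|⁻¹ := by
  have h1 : ∑ j, loss c (a j) = ∑ j, (Complex.log (1 + a j * (Complex.I - c))).re := by
    simp only [loss, Finset.sum_add_distrib, ← Finset.mul_sum, ← h, h0]
    ring
  rw [h1, ← Finset.sum_neg_distrib, Real.exp_sum]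
  refine Finset.prod_le_prod (fun j _ => (Real.exp_pos _).le) fun j _ => ?_
  rw [← Real.exp_log (abs_pos.2 (ha j)), ← Real.exp_neg]
  exact Real.exp_le_exp.2 (neg_le_neg (log_abs_le_log_point_re c (ha j)))

lemma mul_sum_lt_card_mul_pi {m : ℕ} {u : Fin m → ℝ} (hm : 0 < m) (hnz : ∀ j, u j ≠ 0)
    (hu : ∀ j, u j ≤ 1) {x : ℝ} (hx0 : 0 < x) (hx : x < Real.pi) :
    x * ∑ j, u j < ((Finset.univ.filter (fun j => 0 < u j)).card : ℝ) * Real.pi := by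
  rcases (Finset.univ.filter (fun j => 0 < u j)).eq_empty_or_nonempty with he | he
  · rw [he]
    have : ∑ j, u j < 0 := by
      have : Nonempty (Fin m) := ⟨⟨0, hm⟩⟩
      apply Finset.sum_neg _ Finset.univ_nonempty
      intro j _
      have : j ∉ Finset.univ.filter (fun j => 0 < u j) := by simp [he]
      exact lt_of_le_of_ne (by simpa using this) (hnz j)
    simp
    exact mul_neg_of_pos_of_neg hx0 this
  · have hc : (0 : ℝ) < (Finset.univ.filter (fun j => 0 < u j)).card := by
      exact_mod_cast he.card_pos
    have hS : ∑ j, u j ≤ (Finset.univ.filter (fun j => 0 < u j)).card := by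
      rw [Finset.card_filter]
      push_cast
      refine Finset.sum_le_sum fun j _ => ?_
      split_ifs with h
      · exact hu j
      · linarith
    calc x * ∑ j, u j ≤ x * (Finset.univ.filter (fun j => 0 < u j)).card := by gcongr
      _ < _ := by rw [mul_comm]; gcongr

lemma Ioo_subset_Dset {m : ℕ} {u : Fin m → ℝ} (hm : 0 < m) (hnz : ∀ j, u j ≠ 0)
    (hu : ∑ j, u j ^ 2 = 1) : Ioo 0 Real.pi ⊆ Dset u := by
  intro x hx
  have habs : ∀ j, |u j| ≤ 1 := by
    intro j
    rw [← sq_le_one_iff_abs_le_one, ← hu]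
    exact Finset.single_le_sum (f := fun j => u j ^ 2) (fun i _ => sq_nonneg _)
      (Finset.mem_univ j)
  refine ⟨hx.1, ?_, mul_sum_lt_card_mul_pi hm hnz (fun j => (abs_le.1 (habs j)).2) hx.1 hx.2⟩
  have := mul_sum_lt_card_mul_pi (u := fun j => -u j) hm (fun j => neg_ne_zero.2 (hnz j))
    (fun j => by linarith [(abs_le.1 (habs j)).1]) hx.1 hx.2
  simp only [Finset.sum_neg_distrib, Left.neg_pos_iff] at this
  linarith

lemma measurableSet_Eset {m : ℕ} (u : Fin m → ℝ) : MeasurableSet (Eset u) := by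
  have hD : MeasurableSet (Dset u) := by
    have : IsOpen (Dset u) := by
      refine IsOpen.inter isOpen_Ioi (IsOpen.inter ?_ ?_)
      · exact isOpen_lt continuous_const (continuous_id.mul continuous_const)
      · exact isOpen_lt (continuous_id.mul continuous_const) continuous_const
    exact this.measurableSet
  exact (measurableSet_singleton (0 : ℝ)).union (hD.union (measurable_neg hD))

lemma continuousOn_Fchar_re {m : ℕ} {u : Fin m → ℝ} (hnz : ∀ j, u j ≠ 0) {y : ℝ → ℝ}
    {E : Set ℝ} (hyc : ContinuousOn y E) (hy0 : y 0 = 0) :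
    ContinuousOn (fun s : ℝ => (Fchar u (s + Complex.I * y s)).re) E := by
  apply Complex.continuous_re.comp_continuousOn
  have ht : ContinuousOn (fun s : ℝ => (s + Complex.I * y s : ℂ)) E :=
    Complex.continuous_ofReal.continuousOn.add
      (continuousOn_const.mul (Complex.continuous_ofReal.comp_continuousOn hyc))
  refine continuousOn_finsetProd _ fun j _ => ContinuousOn.div ?_ ?_ ?_
  · exact Complex.continuous_exp.comp_continuousOn (continuousOn_const.mul ht)
  · exact continuousOn_const.add (continuousOn_const.mul ht)
  · intro s _ h
    have h1 := congrArg Complex.im h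
    have h2 := congrArg Complex.re h
    simp at h1 h2
    rcases h1 with h1 | h1
    · exact hnz j h1
    · simp [h1, hy0] at h2

theorem stmt19 (n : ℕ) (hn : 1 ≤ n) (u : Fin (n + 1) → ℝ) (hu : ∑ j, (u j) ^ 2 = 1)
    (hnz : ∀ j, u j ≠ 0) (y : ℝ → ℝ)
    (hyc : ContinuousOn y (Eset u))
    (hyev : ∀ x : ℝ, y (-x) = y x)
    (hy0 : y 0 = 0)
    (hyΦ : ∀ x ∈ Dset u, Phi u x (y x) = 0) :
    IntegrableOn (fun s : ℝ => (Fchar u (s + Complex.I * y s)).re) (Eset u) ∧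
    (1 / (2 * Real.pi)) * (∫ s in Eset u, (Fchar u (s + Complex.I * y s)).re) ≥
      1 / Real.exp 1 := by
  set G : ℝ → ℝ := fun s => (Fchar u (s + Complex.I * y s)).re with hG
  have hGeven : ∀ s, G (-s) = G s := by
    intro s
    simp only [hG, hyev]
    exact Fchar_neg_re u s (y s)
  have hG0 : G 0 = 1 := by simp [hG, hy0, Fchar]
  have hang : ∀ s ∈ Dset u, ∑ j, u j * s = ∑ j, angle (y s / s) (u j * s) :=
    fun s hs => sum_eq_sum_angle hnz hs.1 (hyΦ s hs)
  have hGD : ∀ s ∈ Dset u, G s = Real.exp (-∑ j, loss (y s / s) (u j * s)) := by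
    intro s hs
    simp only [hG]
    rw [Fchar_eq_exp hs.1 (hang s hs), Complex.ofReal_re]
  have hind : ∀ p : ℝ → Prop, (∀ s, p (-s) → p s) → p 0 → (∀ s ∈ Dset u, p s) →
      ∀ s ∈ Eset u, p s := by
    rintro p hp h0 hD s (rfl | hs | hs)
    · exact h0
    · exact hD s hs
    · exact hp s (hD _ hs)
  have hGnn : ∀ s ∈ Eset u, 0 ≤ G s := by
    refine hind _ (fun s hs => by rwa [hGeven] at hs) (by simp [hG0]) fun s hs => ?_
    rw [hGD s hs]
    positivity
  have hG1 : ∀ s ∈ Eset u, G s ≤ 1 := by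
    refine hind _ (fun s hs => by rwa [hGeven] at hs) (by simp [hG0]) fun s hs => ?_
    rw [hGD s hs, Real.exp_le_one_iff, neg_nonpos]
    exact Finset.sum_nonneg fun j _ => loss_nonneg _ _
  have hsub : Ioo (-Real.pi) Real.pi ⊆ Eset u := by
    intro s hs
    rcases lt_trichotomy s 0 with h | h | h
    · exact Or.inr (Or.inr (Ioo_subset_Dset n.succ_pos hnz hu ⟨by linarith, by linarith [hs.1]⟩))
    · exact Or.inl h
    · exact Or.inr (Or.inl (Ioo_subset_Dset n.succ_pos hnz hu ⟨h, hs.2⟩))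
  have hlow : ∀ s ∈ Ioo (-Real.pi) Real.pi, Real.exp (-1) * hankelDensity s ≤ G s := by
    have hpos : ∀ s ∈ Ioo 0 Real.pi, Real.exp (-1) * hankelDensity s ≤ G s := by
      intro s hs
      have hsD := Ioo_subset_Dset n.succ_pos hnz hu hs
      rw [hGD s hsD, ← exp_neg_decay ⟨by linarith [hs.1, Real.pi_pos], hs.2⟩]
      refine Real.exp_le_exp.2 (neg_le_neg ?_)
      refine sum_loss_le (fun j => mul_ne_zero (hnz j) hs.1.ne') hs.1 hs.2 ?_ (hang s hsD)
      simp only [mul_pow, ← Finset.sum_mul, hu, one_mul]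
    intro s hs
    rcases lt_trichotomy s 0 with h | rfl | h
    · have := hpos (-s) ⟨by linarith, by linarith [hs.1]⟩
      rw [hGeven] at this
      simpa [hankelDensity] using this
    · rw [hG0]
      simp [hankelDensity, ← Real.exp_add]
    · exact hpos s ⟨h, hs.2⟩
  have hbound : ∃ C, ∀ s ∈ Eset u, G s ≤ C * (1 + s ^ 2)⁻¹ := by
    by_cases hS : ∑ j, u j = 0
    · set A := ∏ j, |u j|⁻¹ with hA
      have hA0 : 0 ≤ A := Finset.prod_nonneg fun j _ => by positivity
      refine ⟨2 * (1 + A), hind _ (fun s hs => ?_) ?_ fun s hs => ?_⟩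
      · rwa [hGeven, neg_sq] at hs
      · rw [hG0]
        norm_num
        linarith
      · have hs0 := hs.1
        rw [← div_eq_mul_inv, le_div_iff₀ (by positivity)]
        have h1 := hG1 s (Or.inr (Or.inl hs))
        have h0 := hGnn s (Or.inr (Or.inl hs))
        rcases le_total s 1 with h | h
        · have : s ^ 2 ≤ 1 := pow_le_one₀ hs0.le h
          nlinarith
        · have h2 : G s ≤ A * (s ^ 2)⁻¹ := by
            rw [hGD s hs]
            refine (exp_neg_sum_loss_le (fun j => mul_ne_zero (hnz j) hs0.ne')
              (by rw [← Finset.sum_mul, hS, zero_mul]) (hang s hs)).trans ?_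
            simp only [abs_mul, mul_inv, Finset.prod_mul_distrib, Finset.prod_const,
              Finset.card_univ, Fintype.card_fin, abs_of_pos hs0]
            rw [inv_pow]
            have := pow_le_pow_right₀ h (show 2 ≤ n + 1 by omega)
            gcongr
          rw [← div_eq_mul_inv, le_div_iff₀ (by positivity)] at h2
          nlinarith
    · set B := ((n : ℝ) + 1) * Real.pi / |∑ j, u j| with hB
      have hSpos : 0 < |∑ j, u j| := abs_pos.2 hS
      refine ⟨1 + B ^ 2, hind _ (fun s hs => ?_) ?_ fun s hs => ?_⟩
      · rwa [hGeven, neg_sq] at hs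
      · rw [hG0]
        norm_num
        positivity
      · have hs0 := hs.1
        rw [← div_eq_mul_inv, le_div_iff₀ (by positivity)]
        have h1 := hG1 s (Or.inr (Or.inl hs))
        have hcard : ∀ p : Fin (n + 1) → Prop, ∀ _ : DecidablePred p,
            ((Finset.univ.filter p).card : ℝ) * Real.pi ≤ ((n : ℝ) + 1) * Real.pi := by
          intro p _
          have := Finset.card_filter_le (Finset.univ : Finset (Fin (n + 1))) p
          rw [Finset.card_univ, Fintype.card_fin] at this
          have h2 : ((Finset.univ.filter p).card : ℝ) ≤ (n : ℝ) + 1 := by exact_mod_cast this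
          exact mul_le_mul_of_nonneg_right h2 Real.pi_pos.le
        have hsB : s ≤ B := by
          rw [hB, le_div_iff₀ hSpos, show s * |∑ j, u j| = |s * ∑ j, u j| by
            rw [abs_mul, abs_of_pos hs0], abs_le]
          exact ⟨by linarith [hs.2.1, hcard (fun j => u j < 0) inferInstance],
            by linarith [hs.2.2, hcard (fun j => 0 < u j) inferInstance]⟩
        have : s ^ 2 ≤ B ^ 2 := pow_le_pow_left₀ hs0.le hsB 2
        nlinarith [sq_nonneg s]
  have hint : IntegrableOn G (Eset u) := by
    obtain ⟨C, hC⟩ := hbound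
    refine Integrable.mono' (g := fun s => C * (1 + s ^ 2)⁻¹)
      (integrable_inv_one_add_sq.const_mul C).integrableOn
      ((continuousOn_Fchar_re hnz hyc hy0).aestronglyMeasurable (measurableSet_Eset u)) ?_
    refine (ae_restrict_iff' (measurableSet_Eset u)).2 (ae_of_all _ fun s hs => ?_)
    rw [Real.norm_of_nonneg (hGnn s hs)]
    exact hC s hs
  refine ⟨hint, ?_⟩
  have hX : ∀ X ∈ Ioo 0 Real.pi, 2 * X * Real.exp (-1) ≤ ∫ s in Eset u, G s := by
    intro X hX
    have hss : Ioc (-X) X ⊆ Ioo (-Real.pi) Real.pi := fun s hs =>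
      ⟨by linarith [hs.1, hX.2], by linarith [hs.2, hX.2]⟩
    have hk : IntegrableOn hankelDensity (Ioc (-X) X) := by
      refine (ContinuousOn.integrableOn_Icc (continuousOn_hankelDensity.mono fun s hs => ?_)).mono_set
        Ioc_subset_Icc_self
      exact ⟨by linarith [hs.1, hX.2], by linarith [hs.2, hX.2]⟩
    calc 2 * X * Real.exp (-1) ≤ (∫ s in (-X)..X, hankelDensity s) * Real.exp (-1) := by
          gcongr
          exact le_integral_hankelDensity hX.1.le hX.2
      _ = ∫ s in Ioc (-X) X, Real.exp (-1) * hankelDensity s := by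
          rw [intervalIntegral.integral_of_le (by linarith [hX.1]), integral_const_mul, mul_comm]
      _ ≤ ∫ s in Ioc (-X) X, G s :=
          setIntegral_mono_on (hk.const_mul _) (hint.mono_set (hss.trans hsub))
            measurableSet_Ioc fun s hs => hlow s (hss hs)
      _ ≤ ∫ s in Eset u, G s :=
          setIntegral_mono_set hint
            ((ae_restrict_iff' (measurableSet_Eset u)).2 (ae_of_all _ hGnn))
            (ae_of_all _ (hss.trans hsub))
  have hlim : 2 * Real.pi * Real.exp (-1) ≤ ∫ s in Eset u, G s := by
    have ht : Tendsto (fun X : ℝ => 2 * X * Real.exp (-1)) (𝓝[<] Real.pi)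
        (𝓝 (2 * Real.pi * Real.exp (-1))) :=
      ((Continuous.tendsto (by fun_prop) _).mono_left nhdsWithin_le_nhds)
    refine le_of_tendsto ht ?_
    filter_upwards [Ioo_mem_nhdsLT Real.pi_pos] with X hX'
    exact hX X hX'
  rw [Real.exp_neg] at hlim
  have hpi := Real.pi_pos
  rw [ge_iff_le, one_div, one_div, ← div_eq_inv_mul, le_div_iff₀ (by positivity)]
  linarith
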